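/- arXiv:1610.07081 — 3 statements merged into one kernel-verified Lean document; each statement's English description precedes it below -/
import Mathlib

section
/- Let a, b, c, d be positive real numbers with b > d, a < c, and I = 0, where I = ∫₀¹ ln((d + x(c−d))/(b + x(a−b))) dx. Then the fixation probability of the frequency-dependent Moran process satisfies lim_{N→∞} ρ_A(N) = (b−d)(c−a) / ( b(c−a) + c(b−d)·√(ac/(bd)) ). -/
open Filter Finset Topology

/-- Fitness of strategy A in the frequency-dependent Moran process. -/
noncomputable def fA (a b : ℝ) (N : ℕ) (i : ℕ) : ℝ :=
  (a * ((i : ℝ) - 1) + b * ((N : ℝ) - (i : ℝ))) / ((N : ℝ) - 1)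

/-- Fitness of strategy B in the frequency-dependent Moran process. -/
noncomputable def fB (c d : ℝ) (N : ℕ) (i : ℕ) : ℝ :=
  (c * (i : ℝ) + d * ((N : ℝ) - (i : ℝ) - 1)) / ((N : ℝ) - 1)

/-- Fixation probability of strategy A in the frequency-dependent Moran process. -/
noncomputable def rhoA (a b c d : ℝ) (N : ℕ) : ℝ :=
  1 / (1 + ∑ k ∈ Icc 1 (N - 1), ∏ j ∈ Icc 1 k, fB c d N j / fA a b N j)

/-- Fixation probability of strategy B in the frequency-dependent Moran process. -/
noncomputable def rhoB (a b c d : ℝ) (N : ℕ) : ℝ :=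
  1 / (1 + ∑ k ∈ Icc 1 (N - 1), ∏ j ∈ Icc 1 k, fA a b N (N - j) / fB c d N (N - j))

/-- Ratio of fitnesses, with `M = N - 1` and `j` shifted by one. -/
noncomputable def rr (a b c d : ℝ) (M j : ℕ) : ℝ :=
  (c * ((j : ℝ) + 1) + d * ((M : ℝ) - j - 1)) / (a * (j : ℝ) + b * ((M : ℝ) - j))

/-- Partial products of the ratios. -/
noncomputable def pp (a b c d : ℝ) (M k : ℕ) : ℝ := ∏ j ∈ range k, rr a b c d M j

lemma rr_den_pos {a b : ℝ} (ha : 0 < a) (hb : 0 < b) {M j : ℕ} (h : j < M) :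
    0 < a * (j : ℝ) + b * ((M : ℝ) - j) := by
  have h1 : (j : ℝ) < M := by exact_mod_cast h
  have h2 : 0 < b * ((M : ℝ) - j) := mul_pos hb (by linarith)
  positivity

lemma rr_num_pos {c d : ℝ} (hc : 0 < c) (hd : 0 < d) {M j : ℕ} (h : j < M) :
    0 < c * ((j : ℝ) + 1) + d * ((M : ℝ) - j - 1) := by
  have h1 : (j : ℝ) + 1 ≤ M := by exact_mod_cast h
  have h2 : 0 ≤ d * ((M : ℝ) - j - 1) := mul_nonneg hd.le (by linarith)
  positivity

lemma rr_pos {a b c d : ℝ} (ha : 0 < a) (hb : 0 < b) (hc : 0 < c) (hd : 0 < d) {M j : ℕ}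
    (h : j < M) : 0 < rr a b c d M j :=
  div_pos (rr_num_pos hc hd h) (rr_den_pos ha hb h)

lemma pp_pos {a b c d : ℝ} (ha : 0 < a) (hb : 0 < b) (hc : 0 < c) (hd : 0 < d) {M k : ℕ}
    (h : k ≤ M) : 0 < pp a b c d M k :=
  prod_pos fun j hj => rr_pos ha hb hc hd (by rw [mem_range] at hj; omega)

lemma rr_swap {a b c d : ℝ} {M i : ℕ} (h : i < M) :
    rr c d a b M 0 = rr c d a b M 0 ∧ rr a b c d M (M - 1 - i) * rr d c b a M i =
      ((c * ((M : ℝ) - i) + d * i) / (a * ((M : ℝ) - 1 - i) + b * (i + 1))) *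
      ((b * ((i : ℝ) + 1) + a * ((M : ℝ) - i - 1)) / (d * (i : ℝ) + c * ((M : ℝ) - i))) := by
  refine ⟨rfl, ?_⟩
  have h1 : ((M - 1 - i : ℕ) : ℝ) = (M : ℝ) - 1 - i := by
    rw [Nat.cast_sub (by omega), Nat.cast_sub (by omega)]; simp
  unfold rr
  rw [h1]
  congr 2 <;> ring

lemma rr_mul_swap {a b c d : ℝ} (ha : 0 < a) (hb : 0 < b) (hc : 0 < c) (hd : 0 < d)
    {M i : ℕ} (h : i < M) : rr a b c d M (M - 1 - i) * rr d c b a M i = 1 := by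
  rw [(rr_swap h).2]
  have h2 := rr_den_pos hd hc h
  have h3 := rr_num_pos hb ha h
  have e1 : c * ((M : ℝ) - i) + d * i = d * (i : ℝ) + c * ((M : ℝ) - i) := by ring
  have e2 : a * ((M : ℝ) - 1 - i) + b * (i + 1) = b * ((i : ℝ) + 1) + a * ((M : ℝ) - i - 1) := by
    ring
  rw [e1, e2]
  field_simp

lemma pp_reflect {a b c d : ℝ} (ha : 0 < a) (hb : 0 < b) (hc : 0 < c) (hd : 0 < d)
    {M m : ℕ} (h : m ≤ M) : pp a b c d M (M - m) = pp a b c d M M * pp d c b a M m := by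
  induction m with
  | zero => simp [pp]
  | succ m ih =>
    have ih := ih (by omega)
    have e : M - m = (M - (m + 1)) + 1 := by omega
    have e2 : M - (m + 1) = M - 1 - m := by omega
    have h1 : pp a b c d M (M - m) = pp a b c d M (M - (m+1)) * rr a b c d M (M - 1 - m) := by
      rw [e, ← e2]; simp only [pp]; rw [prod_range_succ]
    have h2 : pp d c b a M (m + 1) = pp d c b a M m * rr d c b a M m := by
      simp only [pp]; rw [prod_range_succ]
    have h3 := rr_mul_swap ha hb hc hd (M := M) (i := m) (by omega)
    rw [h2, ← mul_assoc, ← ih, h1, mul_assoc, h3, mul_one]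

/-- Bound near the left end. -/
lemma pp_le_left {a b c d : ℝ} (ha : 0 < a) (hb : 0 < b) (hc : 0 < c) (hd : 0 < d)
    (hbd : d < b) : ∃ q : ℝ, ∃ D0 : ℕ, 0 < q ∧ q < 1 ∧ ∀ D ≥ D0, ∀ M k : ℕ, D * k ≤ M →
      k ≤ M → pp a b c d M k ≤ q ^ k := by
  set q := (b + d) / (2 * b) with hq
  have hq1 : q < 1 := by rw [hq, div_lt_one (by positivity)]; linarith
  obtain ⟨D0, hD0⟩ := exists_nat_gt (2 * (c + b) / (b - d))
  refine ⟨q, D0, by positivity, hq1, ?_⟩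
  intro D hD M k hk hkM
  have hD' : 2 * (c + b) / (b - d) < D := lt_of_lt_of_le hD0 (by exact_mod_cast hD)
  rw [div_lt_iff₀ (by linarith)] at hD'
  have hkR : (D : ℝ) * k ≤ M := by exact_mod_cast hk
  have : pp a b c d M k ≤ ∏ j ∈ range k, q := by
    refine prod_le_prod (fun j hj => (rr_pos ha hb hc hd ?_).le) ?_
    · rw [mem_range] at hj; omega
    · intro j hj
      rw [mem_range] at hj
      have hjM : j < M := by omega
      have hj1 : (j : ℝ) + 1 ≤ k := by exact_mod_cast hj
      have hjk : (D : ℝ) * (j + 1) ≤ M := le_trans (by gcongr) hkR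
      unfold rr
      rw [div_le_iff₀ (rr_den_pos ha hb hjM)]
      have hj0 : (0 : ℝ) ≤ j := Nat.cast_nonneg j
      have h2 : q * b = (b + d) / 2 := by rw [hq]; field_simp
      have h3 : 0 ≤ q * a * j := by positivity
      have h4 : 2 * (c + b) * (j + 1) ≤ (b - d) * M := by nlinarith
      have h5 : q * (a * j + b * (M - j)) = q * a * j + (b + d) / 2 * (M - j) := by
        rw [← h2]; ring
      rw [h5]
      nlinarith
  simpa using this

lemma rr_le_one_iff {a b c d : ℝ} (ha : 0 < a) (hb : 0 < b) {M j : ℕ} (h : j < M) :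
    rr a b c d M j ≤ 1 ↔
      c * ((j : ℝ) + 1) + d * ((M : ℝ) - j - 1) ≤ a * (j : ℝ) + b * ((M : ℝ) - j) := by
  unfold rr
  rw [div_le_one (rr_den_pos ha hb h)]

lemma pp_mid {a b c d : ℝ} (ha : 0 < a) (hb : 0 < b) (hc : 0 < c) (hd : 0 < d)
    (hbd : d < b) (hac : a < c) {M K k L : ℕ} (h1 : K ≤ k) (h2 : k ≤ L) (h3 : L ≤ M) :
    pp a b c d M k ≤ max (pp a b c d M K) (pp a b c d M L) := by
  rcases eq_or_lt_of_le (h2.trans h3) with h | hkM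
  · have : k = L := by omega
    subst this; exact le_max_right _ _
  by_cases hr : rr a b c d M k ≤ 1
  · apply le_max_of_le_left
    rw [rr_le_one_iff ha hb hkM] at hr
    unfold pp
    rw [← prod_range_mul_prod_Ico _ h1]
    apply mul_le_of_le_one_right (pp_pos ha hb hc hd (by omega)).le
    apply prod_le_one
    · intro j hj
      rw [mem_Ico] at hj
      exact (rr_pos ha hb hc hd (by omega)).le
    · intro j hj
      rw [mem_Ico] at hj
      rw [rr_le_one_iff ha hb (by omega)]
      have : (j : ℝ) ≤ k := by exact_mod_cast hj.2.le
      nlinarith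
  · apply le_max_of_le_right
    rw [rr_le_one_iff ha hb hkM, not_le] at hr
    unfold pp
    rw [← prod_range_mul_prod_Ico _ h2]
    apply le_mul_of_one_le_right (pp_pos ha hb hc hd (by omega)).le
    suffices h : ∏ _j ∈ Ico k L, (1 : ℝ) ≤ ∏ j ∈ Ico k L, rr a b c d M j by simpa using h
    refine prod_le_prod (fun _ _ => zero_le_one) ?_
    intro j hj
    rw [mem_Ico] at hj
    unfold rr
    rw [one_le_div (rr_den_pos ha hb (by omega))]
    have : (k : ℝ) ≤ j := by exact_mod_cast hj.1
    nlinarith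

lemma pp_dom {a b c d : ℝ} (ha : 0 < a) (hb : 0 < b) (hc : 0 < c) (hd : 0 < d)
    (hbd : d < b) (hac : a < c) {C : ℝ} (hC : ∀ᶠ M in atTop, pp a b c d M M ≤ C) :
    ∃ t E : ℝ, 0 < t ∧ t < 1 ∧ ∀ᶠ M : ℕ in atTop, ∀ k, 2 * k ≤ M →
      pp a b c d M k ≤ E * t ^ k := by
  obtain ⟨q1, D1, hq1, hq1', H1⟩ := pp_le_left ha hb hc hd hbd
  obtain ⟨q2, D2, hq2, hq2', H2⟩ := pp_le_left hd hc hb ha hac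
  set q := max q1 q2 with hq
  have hq0 : 0 < q := lt_max_of_lt_left hq1
  have hqlt : q < 1 := max_lt hq1' hq2'
  obtain ⟨D, hD⟩ : ∃ D : ℕ, D = D1 + D2 + 2 := ⟨_, rfl⟩
  have hD0 : (2 : ℝ) ≤ D := by rw [hD]; push_cast; linarith [Nat.cast_nonneg (α := ℝ) D1, Nat.cast_nonneg (α := ℝ) D2]
  set t := 1 - (1 - q) / D with ht
  have htlt : t < 1 := by
    have : 0 < (1 - q) / D := div_pos (by linarith) (by linarith)
    linarith
  have hqt : q ≤ t := by
    have : (1 - q) / D ≤ 1 - q := div_le_self (by linarith) (by linarith)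
    linarith
  have ht0 : 0 < t := lt_of_lt_of_le hq0 hqt
  have htD : q ≤ t ^ D := by
    have := one_add_mul_le_pow (a := -((1 - q) / D)) (by linarith) D
    have e : 1 + (D : ℝ) * (-((1 - q) / D)) = q := by field_simp; ring
    rw [e] at this
    rwa [← sub_eq_add_neg, ← ht] at this
  have hP1 : ∀ M k : ℕ, D * k ≤ M → pp a b c d M k ≤ q ^ k := by
    intro M k hk
    refine (H1 D (by omega) M k hk (by nlinarith)).trans ?_
    exact pow_le_pow_left₀ hq1.le (le_max_left _ _) k
  have hP2 : ∀ M k : ℕ, D * k ≤ M → pp d c b a M k ≤ q ^ k := by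
    intro M k hk
    refine (H2 D (by omega) M k hk (by nlinarith)).trans ?_
    exact pow_le_pow_left₀ hq2.le (le_max_right _ _) k
  set E := max 1 C / t ^ D with hE
  have hm1 : 1 ≤ max 1 C := le_max_left _ _
  have htDle : t ^ D ≤ 1 := pow_le_one₀ ht0.le htlt.le
  have htDpos : 0 < t ^ D := by positivity
  refine ⟨t, E, ht0, htlt, ?_⟩
  filter_upwards [hC] with M hCM k hk
  set K := M / D with hK
  have hDK : D * K ≤ M := Nat.mul_div_le M D
  have hDK2 : M ≤ D * K + D := by
    have h5 := Nat.div_add_mod M D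
    have h6 := Nat.mod_lt M (show 0 < D by omega)
    rw [← hK] at h5
    omega
  have h2K : 2 * K ≤ M := le_trans (Nat.mul_le_mul_right K (by omega)) hDK
  have hE1 : 1 ≤ E := by rw [hE, one_le_div htDpos]; linarith
  by_cases hkK : k ≤ K
  · calc pp a b c d M k ≤ q ^ k := hP1 M k (le_trans (Nat.mul_le_mul_left D hkK) hDK)
      _ ≤ t ^ k := pow_le_pow_left₀ hq0.le hqt k
      _ ≤ E * t ^ k := le_mul_of_one_le_left (by positivity) hE1
  · have hqK : q ^ K * t ^ D ≤ t ^ k := by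
      calc q ^ K * t ^ D ≤ (t ^ D) ^ K * t ^ D := by gcongr
        _ = t ^ (D * K + D) := by rw [← pow_mul, pow_add]
        _ ≤ t ^ k := pow_le_pow_of_le_one ht0.le htlt.le (by omega)
    have hmid := pp_mid ha hb hc hd hbd hac (M := M) (K := K) (k := k) (L := M - K)
      (by omega) (by omega) (by omega)
    have hA : pp a b c d M K ≤ max 1 C * q ^ K :=
      (hP1 M K hDK).trans (le_mul_of_one_le_left (by positivity) hm1)
    have hB : pp a b c d M (M - K) ≤ max 1 C * q ^ K := by
      rw [pp_reflect ha hb hc hd (by omega)]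
      exact mul_le_mul (hCM.trans (le_max_right _ _)) (hP2 M K hDK)
        (pp_pos hd hc hb ha (by omega)).le (by linarith)
    calc pp a b c d M k ≤ max 1 C * q ^ K := hmid.trans (max_le hA hB)
      _ = E * (q ^ K * t ^ D) := by rw [hE]; field_simp
      _ ≤ E * t ^ k := by gcongr

lemma rr_tendsto {a b c d : ℝ} (hb : 0 < b) (j : ℕ) :
    Tendsto (fun M : ℕ => rr a b c d M j) atTop (𝓝 (d / b)) := by
  have hinv : Tendsto (fun M : ℕ => ((M : ℝ))⁻¹) atTop (𝓝 0) :=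
    tendsto_inv_atTop_zero.comp tendsto_natCast_atTop_atTop
  have h1 : Tendsto (fun M : ℕ => ((c - d) * ((j : ℝ) + 1) * (M : ℝ)⁻¹ + d) /
      ((a - b) * j * (M : ℝ)⁻¹ + b)) atTop (𝓝 (((c - d) * ((j : ℝ) + 1) * 0 + d) /
      ((a - b) * j * 0 + b))) := by
    apply Tendsto.div
    · exact (hinv.const_mul _).add_const _
    · exact (hinv.const_mul _).add_const _
    · simpa using hb.ne'
  simp only [mul_zero, zero_add] at h1
  refine h1.congr' ?_
  filter_upwards [eventually_gt_atTop 0] with M hM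
  have hM' : (M : ℝ) ≠ 0 := by positivity
  unfold rr
  rw [← mul_div_mul_right _ _ hM']
  congr 1 <;> field_simp <;> ring

lemma sum_tendsto {a b c d : ℝ} (ha : 0 < a) (hb : 0 < b) (hc : 0 < c) (hd : 0 < d)
    (hbd : d < b) (hac : a < c) {C : ℝ} (hC : ∀ᶠ M in atTop, pp a b c d M M ≤ C)
    (L : ℕ → ℕ) (hL : Tendsto L atTop atTop) (hL2 : ∀ M, 2 * L M ≤ M + 2) :
    Tendsto (fun M => ∑ k ∈ range (L M), pp a b c d M k) atTop (𝓝 (b / (b - d))) := by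
  obtain ⟨t, E, ht0, ht1, H⟩ := pp_dom ha hb hc hd hbd hac hC
  have hdb : d / b < 1 := by rw [div_lt_one hb]; exact hbd
  have hsum : ∑' k : ℕ, (d / b) ^ k = b / (b - d) := by
    rw [tsum_geometric_of_lt_one (by positivity) hdb]
    have : b - d ≠ 0 := by linarith
    field_simp
  rw [← hsum]
  have e : ∀ M, ∑ k ∈ range (L M), pp a b c d M k =
      ∑' k, (if k < L M then pp a b c d M k else 0) := by
    intro M
    rw [tsum_eq_sum (s := range (L M))]
    · apply sum_congr rfl
      intro k hk
      rw [if_pos (mem_range.mp hk)]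
    · intro k hk
      rw [if_neg (by simpa using hk)]
  simp_rw [e]
  refine tendsto_tsum_of_dominated_convergence (bound := fun k => |E| * t ^ k) ?_ ?_ ?_
  · exact (summable_geometric_of_lt_one ht0.le ht1).mul_left _
  · intro k
    have h1 : Tendsto (fun M => pp a b c d M k) atTop (𝓝 ((d / b) ^ k)) := by
      have := tendsto_finsetProd (range k) (fun j _ => rr_tendsto (a := a) (c := c) (d := d) hb j)
      simpa [pp, div_pow] using this
    refine h1.congr' ?_
    filter_upwards [hL.eventually_gt_atTop k] with M hM
    rw [if_pos hM]
  · filter_upwards [H] with M hM k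
    split_ifs with hk
    · have h2 := hL2 M
      rw [Real.norm_of_nonneg (pp_pos ha hb hc hd (by omega)).le]
      refine (hM k (by omega)).trans ?_
      gcongr
      exact le_abs_self E
    · simp; positivity

lemma trap {f : ℝ → ℝ} (hf : ContDiffOn ℝ 2 f (Set.uIcc 0 1)) :
    Tendsto (fun M : ℕ => ∑ k ∈ range M, f (((k : ℝ) + 1) / M) - M * ∫ x in (0:ℝ)..1, f x) atTop
      (𝓝 ((f 1 - f 0) / 2)) := by
  have hu : UniqueDiffOn ℝ (Set.uIcc (0:ℝ) 1) := uniqueDiffOn_uIcc zero_ne_one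
  have hcont := hf.continuousOn_iteratedDerivWithin (m := 2) le_rfl hu
  obtain ⟨ζ, hζ⟩ := isCompact_uIcc.exists_bound_of_continuousOn hcont
  have hζ0 : 0 ≤ ζ := (norm_nonneg _).trans (hζ 0 Set.left_mem_uIcc)
  have hb : ∀ x, |iteratedDerivWithin 2 f (Set.uIcc 0 1) x| ≤ ζ := by
    intro x
    by_cases hx : x ∈ Set.uIcc (0:ℝ) 1
    · exact hζ x hx
    · rw [iteratedDerivWithin_succ, derivWithin_zero_of_notMem_closure
        (by rwa [isCompact_uIcc.isClosed.closure_eq]), abs_zero]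
      exact hζ0
  have key := fun N (hN : 0 < N) => trapezoidal_error_le_of_c2 hf hb (N := N) hN
  have hz : Tendsto (fun M : ℕ => (M : ℝ) * trapezoidal_error f M 0 1) atTop (𝓝 0) := by
    have hinv : Tendsto (fun M : ℕ => ζ / 12 * ((M : ℝ))⁻¹) atTop (𝓝 0) := by
      simpa using (tendsto_inv_atTop_zero.comp tendsto_natCast_atTop_atTop).const_mul (ζ / 12)
    refine squeeze_zero_norm' ?_ hinv
    filter_upwards [eventually_gt_atTop 0] with M hM
    have hM' : (0 : ℝ) < M := by exact_mod_cast hM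
    rw [norm_mul, Real.norm_of_nonneg hM'.le, Real.norm_eq_abs]
    calc (M : ℝ) * |trapezoidal_error f M 0 1| ≤ M * (|1 - 0| ^ 3 * ζ / (12 * M ^ 2)) := by
          gcongr; exact key M hM
      _ = ζ / 12 * (M : ℝ)⁻¹ := by simp; field_simp
  have := hz.add_const ((f 1 - f 0) / 2)
  rw [zero_add] at this
  refine this.congr' ?_
  filter_upwards [eventually_gt_atTop 0] with M hM
  have hM' : (M : ℝ) ≠ 0 := by positivity
  obtain ⟨n, rfl⟩ : ∃ n, M = n + 1 := ⟨M - 1, by omega⟩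
  rw [sum_range_succ]
  unfold trapezoidal_error trapezoidal_integral
  have e : ((n : ℝ) + 1) / ((n + 1 : ℕ) : ℝ) = 1 := by
    push_cast at hM' ⊢; exact div_self hM'
  rw [e]
  simp only [Nat.add_sub_cancel, sub_zero, mul_one, zero_add]
  rw [mul_sub, ← mul_assoc, mul_one_div_cancel hM']
  ring

lemma affine_pos {p s x : ℝ} (hp : 0 < p) (hs : 0 < s) (hx : x ∈ Set.uIcc (0:ℝ) 1) :
    0 < p + x * (s - p) := by
  rw [Set.uIcc_of_le zero_le_one] at hx
  obtain ⟨h0, h1⟩ := hx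
  rcases le_total p s with h | h
  · nlinarith
  · nlinarith

lemma log_c2 {p s : ℝ} (hp : 0 < p) (hs : 0 < s) :
    ContDiffOn ℝ 2 (fun x => Real.log (p + x * (s - p))) (Set.uIcc 0 1) := by
  apply ContDiffOn.log
  · fun_prop
  · intro x hx
    exact (affine_pos hp hs hx).ne'

lemma pp_full {a b c d : ℝ} (ha : 0 < a) (hb : 0 < b) (hc : 0 < c) (hd : 0 < d)
    (hI : (∫ x in (0 : ℝ)..1, Real.log ((d + x * (c - d)) / (b + x * (a - b)))) = 0) :
    Tendsto (fun M => pp a b c d M M) atTop (𝓝 (Real.sqrt (a * c / (b * d)))) := by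
  have hg := log_c2 hd hc
  have hh := log_c2 hb ha
  have hI2 : (∫ x in (0:ℝ)..1, Real.log (d + x * (c - d))) =
      ∫ x in (0:ℝ)..1, Real.log (b + x * (a - b)) := by
    have e : (∫ x in (0 : ℝ)..1, Real.log ((d + x * (c - d)) / (b + x * (a - b)))) =
        ∫ x in (0 : ℝ)..1, (Real.log (d + x * (c - d)) - Real.log (b + x * (a - b))) := by
      apply intervalIntegral.integral_congr
      intro x hx
      exact Real.log_div (affine_pos hd hc hx).ne' (affine_pos hb ha hx).ne'
    rw [e, intervalIntegral.integral_sub hg.continuousOn.intervalIntegrable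
      hh.continuousOn.intervalIntegrable] at hI
    linarith
  have h1 := (trap hg).sub (trap hh)
  have h2 := h1.add_const (Real.log a - Real.log b)
  have hlog : Tendsto (fun M => Real.log (pp a b c d M M)) atTop
      (𝓝 ((Real.log a + Real.log c - Real.log b - Real.log d) / 2)) := by
    convert h2.congr' ?_ using 2
    · simp; ring
    · filter_upwards [eventually_gt_atTop 0] with M hM
      have hM' : (0 : ℝ) < M := by exact_mod_cast hM
      rw [hI2]
      unfold pp
      rw [Real.log_prod (fun j hj => (rr_pos ha hb hc hd (mem_range.mp hj)).ne')]
      have e1 : ∀ j ∈ range M, Real.log (rr a b c d M j) =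
          Real.log (d + ((j:ℝ) + 1) / M * (c - d)) - Real.log (b + (j : ℝ) / M * (a - b)) := by
        intro j hj
        rw [mem_range] at hj
        have hn := rr_num_pos hc hd hj
        have hdn := rr_den_pos ha hb hj
        have n1 : d + ((j:ℝ) + 1) / M * (c - d) =
          (c * ((j : ℝ) + 1) + d * ((M : ℝ) - j - 1)) / M := by field_simp; ring
        have n2 : b + (j : ℝ) / M * (a - b) = (a * (j : ℝ) + b * ((M : ℝ) - j)) / M := by
          field_simp; ring
        rw [n1, n2, ← Real.log_div (by positivity) (by positivity), div_div_div_cancel_right₀ hM'.ne']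
        rfl
      rw [sum_congr rfl e1, sum_sub_distrib]
      have e2 : ∑ j ∈ range M, Real.log (b + (j : ℝ) / M * (a - b)) + Real.log a =
          ∑ j ∈ range M, Real.log (b + ((j : ℝ) + 1) / M * (a - b)) + Real.log b := by
        have s1 := sum_range_succ (fun j : ℕ => Real.log (b + (j : ℝ) / M * (a - b))) M
        have s2 := sum_range_succ' (fun j : ℕ => Real.log (b + (j : ℝ) / M * (a - b))) M
        rw [s1] at s2
        simpa [div_self hM'.ne'] using s2
      linarith
  have h3 := (Real.continuous_exp.tendsto _).comp hlog
  have e : Real.exp ((Real.log a + Real.log c - Real.log b - Real.log d) / 2) =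
      Real.sqrt (a * c / (b * d)) := by
    rw [← Real.exp_log (show 0 < Real.sqrt (a * c / (b * d)) by positivity),
      Real.log_sqrt (by positivity), Real.log_div (by positivity) (by positivity),
      Real.log_mul ha.ne' hc.ne', Real.log_mul hb.ne' hd.ne']
    congr 2; ring
  rw [e] at h3
  refine h3.congr ?_
  intro M
  exact Real.exp_log (pp_pos ha hb hc hd le_rfl)

lemma rhoA_eq {a b c d : ℝ} {M : ℕ} (hM : 0 < M) :
    rhoA a b c d (M + 1) = 1 / ∑ k ∈ range (M + 1), pp a b c d M k := by
  unfold rhoA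
  have hM' : (M : ℝ) ≠ 0 := by positivity
  have e : ∀ k, ∏ j ∈ Icc 1 k, fB c d (M + 1) j / fA a b (M + 1) j = pp a b c d M k := by
    intro k
    unfold pp
    rw [← Finset.Ico_add_one_right_eq_Icc, prod_Ico_eq_prod_range]
    apply prod_congr (by simp)
    intro j _
    unfold fA fB rr
    push_cast
    rw [div_div_div_cancel_right₀ (by simpa using hM')]
    congr 1 <;> ring
  simp_rw [e]
  rw [sum_range_succ', ← Finset.Ico_add_one_right_eq_Icc, sum_Ico_eq_sum_range]
  congr 1
  rw [add_comm]
  congr 1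
  · apply sum_congr (by simp)
    intro k _
    rw [add_comm]

/-- If b > d, a < c and I = 0, then
ρ_A → (b−d)(c−a)/(b(c−a) + c(b−d)√(ac/(bd))) as N → ∞. -/
theorem rhoA_largeN_I_zero (a b c d : ℝ) (ha : 0 < a) (hb : 0 < b) (hc : 0 < c)
    (hd : 0 < d) (hbd : b > d) (hac : a < c)
    (hI : (∫ x in (0 : ℝ)..1, Real.log ((d + x * (c - d)) / (b + x * (a - b)))) = 0) :
    Tendsto (fun N : ℕ => rhoA a b c d N) atTop
      (𝓝 ((b - d) * (c - a) /
        (b * (c - a) + c * (b - d) * Real.sqrt (a * c / (b * d))))) := by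
  have hfull := pp_full ha hb hc hd hI
  set S := Real.sqrt (a * c / (b * d)) with hS
  have hS0 : 0 < S := by rw [hS]; positivity
  have hC : ∀ᶠ M in atTop, pp a b c d M M ≤ S + 1 :=
    hfull.eventually_le_const (by linarith)
  have hrefl : ∀ M, pp a b c d M M * pp d c b a M M = 1 := by
    intro M
    rw [← pp_reflect ha hb hc hd le_rfl]
    simp [pp]
  have hfull' : Tendsto (fun M => pp d c b a M M) atTop (𝓝 S⁻¹) := by
    refine (hfull.inv₀ hS0.ne').congr ?_
    intro M
    exact inv_eq_of_mul_eq_one_right (hrefl M)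
  have hC' : ∀ᶠ M in atTop, pp d c b a M M ≤ S⁻¹ + 1 :=
    hfull'.eventually_le_const (by linarith)
  have t1 := sum_tendsto ha hb hc hd hbd hac hC (fun M => M / 2 + 1)
    (tendsto_atTop.2 fun n => by
      filter_upwards [eventually_ge_atTop (2 * n)] with M hM
      omega) (fun M => by omega)
  have t2 := sum_tendsto hd hc hb ha hac hbd hC' (fun M => M - M / 2)
    (tendsto_atTop.2 fun n => by
      filter_upwards [eventually_ge_atTop (2 * n)] with M hM
      omega) (fun M => by omega)
  have t3 := t1.add (hfull.mul t2)
  have hsum : ∀ M, ∑ k ∈ range (M / 2 + 1), pp a b c d M k +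
      pp a b c d M M * ∑ k ∈ range (M - M / 2), pp d c b a M k =
      ∑ k ∈ range (M + 1), pp a b c d M k := by
    intro M
    rw [← sum_range_add_sum_Ico _ (show M / 2 + 1 ≤ M + 1 by omega), mul_sum,
      sum_Ico_eq_sum_range]
    congr 1
    rw [← sum_range_reflect]
    apply sum_congr (by congr 1; omega)
    intro k hk
    rw [mem_range] at hk
    rw [← pp_reflect ha hb hc hd (by omega)]
    congr 1
    omega
  have t4 := t3.congr hsum
  have hbd' : b - d ≠ 0 := by linarith
  have hca' : c - a ≠ 0 := by linarith
  have p1 : 0 < b / (b - d) := div_pos hb (by linarith)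
  have p2 : 0 < c / (c - a) := div_pos hc (by linarith)
  have t5 := t4.inv₀ (by positivity)
  rw [← tendsto_add_atTop_iff_nat 1]
  have e : (b / (b - d) + S * (c / (c - a)))⁻¹ =
      (b - d) * (c - a) / (b * (c - a) + c * (b - d) * S) := by
    rw [inv_eq_one_div, div_add' _ _ _ hbd']
    field_simp
  rw [e] at t5
  refine t5.congr' ?_
  filter_upwards [eventually_gt_atTop 0] with M hM
  rw [rhoA_eq hM, one_div]
end

section
/- Let a, b, c, d be positive real numbers and let I = ∫₀¹ ln((d + x(c−d))/(b + x(a−b))) dx. Then ρ_A(N) > 1/N holds for all sufficiently large N if and only if one of the following holds: (i) b > d and a ≥ c; (ii) b > d, a < c and I ≤ 0; (iii) b = d and a > c; (iv) b = d, a = c and b > c. -/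
open Filter Finset Topology

/-- The log fitness ratio. -/
noncomputable def phi (a b c d : ℝ) (x : ℝ) : ℝ :=
  Real.log ((d + x * (c - d)) / (b + x * (a - b)))

/-- Its primitive. -/
noncomputable def Phi (a b c d : ℝ) (x : ℝ) : ℝ := ∫ t in (0:ℝ)..x, phi a b c d t

/-- Products in the fixation probability. -/
noncomputable def PP (a b c d : ℝ) (M : ℕ) (k : ℕ) : ℝ :=
  ∏ j ∈ Icc 1 k, fB c d (M+1) j / fA a b (M+1) j

lemma aff_ge (u v x : ℝ) (h0 : 0 ≤ x) (h1 : x ≤ 1) : min u v ≤ u + x * (v - u) := by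
  rcases le_total u v with h | h
  · rw [min_eq_left h]; nlinarith
  · rw [min_eq_right h]; nlinarith

lemma aff_pos {u v x : ℝ} (hu : 0 < u) (hv : 0 < v) (h0 : 0 ≤ x) (h1 : x ≤ 1) :
    0 < u + x * (v - u) := lt_of_lt_of_le (lt_min hu hv) (aff_ge u v x h0 h1)

lemma log_sub_le {m x y : ℝ} (hm : 0 < m) (hx : m ≤ x) (hy : m ≤ y) :
    |Real.log x - Real.log y| ≤ |x - y| / m := by
  have key : ∀ x y : ℝ, m ≤ x → m ≤ y → Real.log x - Real.log y ≤ |x - y| / m := by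
    intro x y hx hy
    have hx0 : 0 < x := by linarith
    have hy0 : 0 < y := by linarith
    rw [← Real.log_div hx0.ne' hy0.ne']
    have h1 := Real.log_le_sub_one_of_pos (div_pos hx0 hy0)
    have h2 : x / y - 1 = (x - y) / y := by field_simp
    rw [h2] at h1
    calc _ ≤ (x - y) / y := h1
      _ ≤ |x - y| / y := by gcongr; exact le_abs_self _
      _ ≤ |x - y| / m := by gcongr
  rw [abs_le]
  constructor
  · have := key y x hy hx
    rw [abs_sub_comm] at this
    linarith
  · exact key x y hx hy

lemma log_aff_lip {u v x y : ℝ} (hu : 0 < u) (hv : 0 < v) (hx : 0 ≤ x) (hx1 : x ≤ 1)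
    (hy : 0 ≤ y) (hy1 : y ≤ 1) :
    |Real.log (u + x * (v - u)) - Real.log (u + y * (v - u))| ≤
      |v - u| / min u v * |x - y| := by
  refine (log_sub_le (lt_min hu hv) (aff_ge u v x hx hx1) (aff_ge u v y hy hy1)).trans ?_
  have : u + x * (v - u) - (u + y * (v - u)) = (v - u) * (x - y) := by ring
  rw [this, abs_mul]
  apply le_of_eq; ring

lemma phi_eq {a b c d x : ℝ} (ha : 0 < a) (hb : 0 < b) (hc : 0 < c) (hd : 0 < d)
    (h0 : 0 ≤ x) (h1 : x ≤ 1) :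
    phi a b c d x = Real.log (d + x * (c - d)) - Real.log (b + x * (a - b)) :=
  Real.log_div (aff_pos hd hc h0 h1).ne' (aff_pos hb ha h0 h1).ne'

lemma phi_cont {a b c d : ℝ} (ha : 0 < a) (hb : 0 < b) (hc : 0 < c) (hd : 0 < d) :
    ContinuousOn (phi a b c d) (Set.Icc 0 1) := by
  unfold phi
  apply ContinuousOn.log
  · apply ContinuousOn.div
    · fun_prop
    · fun_prop
    · intro x hx; exact (aff_pos hb ha hx.1 hx.2).ne'
  · intro x hx
    exact (div_pos (aff_pos hd hc hx.1 hx.2) (aff_pos hb ha hx.1 hx.2)).ne'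

lemma phi_int {a b c d s t : ℝ} (ha : 0 < a) (hb : 0 < b) (hc : 0 < c) (hd : 0 < d)
    (hs : 0 ≤ s) (hs1 : s ≤ 1) (ht : 0 ≤ t) (ht1 : t ≤ 1) :
    IntervalIntegrable (phi a b c d) MeasureTheory.volume s t := by
  apply ContinuousOn.intervalIntegrable
  apply (phi_cont ha hb hc hd).mono
  exact Set.uIcc_subset_Icc ⟨hs, hs1⟩ ⟨ht, ht1⟩

lemma Phi_cont {a b c d : ℝ} (ha : 0 < a) (hb : 0 < b) (hc : 0 < c) (hd : 0 < d) :
    ContinuousOn (Phi a b c d) (Set.Icc 0 1) := by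
  have h := intervalIntegral.continuousOn_primitive_interval' (f := phi a b c d) (a := 0)
    (b₁ := 0) (b₂ := 1) (μ := MeasureTheory.volume)
    (phi_int ha hb hc hd le_rfl zero_le_one zero_le_one le_rfl) (by simp)
  rwa [Set.uIcc_of_le zero_le_one] at h

/-- ratio in terms of affine functions. -/
lemma ratio_eq (a b c d : ℝ) (M j : ℕ) (hM : 0 < M) :
    fB c d (M+1) (j+1) / fA a b (M+1) (j+1) =
      (d + ((j+1 : ℕ) / (M:ℝ)) * (c - d)) / (b + ((j:ℝ) / M) * (a - b)) := by
  have hM' : (M:ℝ) ≠ 0 := by positivity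
  unfold fA fB
  push_cast
  have e1 : (c * ((j:ℝ)+1) + d * ((M:ℝ)+1-(j+1)-1)) / ((M:ℝ)+1-1)
     = d + (((j:ℝ)+1) / (M:ℝ)) * (c - d) := by field_simp; ring_nf; field_simp; ring
  have e2 : (a * ((j:ℝ)+1-1) + b * ((M:ℝ)+1-(j+1))) / ((M:ℝ)+1-1)
     = b + ((j:ℝ) / M) * (a - b) := by field_simp; ring_nf; field_simp; ring
  rw [e1, e2]

/-- Lipschitz-type constant. -/
noncomputable def KK (a b c d : ℝ) : ℝ := |c - d| / min d c + |a - b| / min b a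

lemma KK_nonneg {a b c d : ℝ} (ha : 0 < a) (hb : 0 < b) (hc : 0 < c) (hd : 0 < d) :
    0 ≤ KK a b c d := by
  have := lt_min hd hc
  have := lt_min hb ha
  unfold KK; positivity

lemma PP_est {a b c d : ℝ} (ha : 0 < a) (hb : 0 < b) (hc : 0 < c) (hd : 0 < d)
    (M : ℕ) (hM : 0 < M) (k : ℕ) (hk : k ≤ M) :
    0 < PP a b c d M k ∧
    |Real.log (PP a b c d M k) - M * Phi a b c d (k / M)| ≤ KK a b c d * (k / M) := by
  have hM' : (0:ℝ) < M := by positivity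
  induction k with
  | zero => simp [PP, Phi]
  | succ k ih =>
    obtain ⟨ih1, ih2⟩ := ih (by omega)
    have hs0 : (0:ℝ) ≤ k / M := by positivity
    have hs1 : (k:ℝ) / M ≤ 1 := by rw [div_le_one hM']; exact_mod_cast (by omega)
    have ht0 : (0:ℝ) ≤ (k+1:ℕ) / M := by positivity
    have ht1 : ((k+1:ℕ):ℝ) / M ≤ 1 := by rw [div_le_one hM']; exact_mod_cast hk
    have hst : ((k+1:ℕ):ℝ) / M - k / M = 1 / M := by push_cast; ring
    have hP : PP a b c d M (k+1) = PP a b c d M k *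
        ((d + ((k+1 : ℕ) / (M:ℝ)) * (c - d)) / (b + ((k:ℝ) / M) * (a - b))) := by
      unfold PP
      rw [Finset.prod_Icc_succ_top (by omega), ratio_eq a b c d M k hM]
    generalize ((k:ℝ)/M) = s at *
    generalize (((k+1:ℕ):ℝ)/M) = t at *
    have hg := aff_pos hd hc ht0 ht1
    have hh := aff_pos hb ha hs0 hs1
    have hle : s ≤ t := by
      have : (0:ℝ) < 1 / M := by positivity
      linarith
    refine ⟨by rw [hP]; positivity, ?_⟩
    rw [hP, Real.log_mul ih1.ne' (by positivity), Real.log_div hg.ne' hh.ne']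
    have hPhi : Phi a b c d t = Phi a b c d s + ∫ x in s..t, phi a b c d x := by
      unfold Phi
      rw [intervalIntegral.integral_add_adjacent_intervals]
      · exact phi_int ha hb hc hd le_rfl zero_le_one hs0 hs1
      · exact phi_int ha hb hc hd hs0 hs1 ht0 ht1
    set v := Real.log (d + t * (c - d)) - Real.log (b + s * (a - b)) with hv
    have hint : |(∫ x in s..t, phi a b c d x) - (t - s) * v| ≤ KK a b c d * (t - s) * (t - s) := by
      have e : (∫ x in s..t, phi a b c d x) - (t - s) * v = ∫ x in s..t, (phi a b c d x - v) := by
        rw [intervalIntegral.integral_sub (phi_int ha hb hc hd hs0 hs1 ht0 ht1)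
          intervalIntegrable_const]
        simp
      rw [e]
      have := intervalIntegral.norm_integral_le_of_norm_le_const (a := s) (b := t)
        (f := fun x => phi a b c d x - v) (C := KK a b c d * (t - s)) (by
          intro x hx
          rw [Set.uIoc_of_le hle] at hx
          have hx0 : 0 ≤ x := by linarith [hx.1]
          have hx1 : x ≤ 1 := by linarith [hx.2]
          rw [Real.norm_eq_abs, phi_eq ha hb hc hd hx0 hx1, hv]
          have h1 := log_aff_lip hd hc hx0 hx1 ht0 ht1
          have h2 := log_aff_lip hb ha hs0 hs1 hx0 hx1
          have h3 : |x - t| ≤ t - s := by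
            rw [abs_le]; constructor <;> linarith [hx.1, hx.2]
          have h4 : |s - x| ≤ t - s := by
            rw [abs_le]; constructor <;> linarith [hx.1, hx.2]
          have p1 := lt_min hd hc
          have p2 := lt_min hb ha
          have h1' := h1.trans (mul_le_mul_of_nonneg_left h3 (by positivity))
          have h2' := h2.trans (mul_le_mul_of_nonneg_left h4 (by positivity))
          rw [abs_le] at h1' h2' ⊢
          unfold KK
          constructor <;> linarith [h1'.1, h1'.2, h2'.1, h2'.2])
      rwa [Real.norm_eq_abs, abs_of_nonneg (by linarith : 0 ≤ t - s)] at this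
    rw [hst] at hint
    have hint2 : |M * (∫ x in s..t, phi a b c d x) - v| ≤ KK a b c d * (1 / M) := by
      have e : M * (∫ x in s..t, phi a b c d x) - v
        = M * ((∫ x in s..t, phi a b c d x) - 1 / M * v) := by field_simp
      rw [e, abs_mul, abs_of_pos hM']
      calc _ ≤ M * (KK a b c d * (1 / M) * (1 / M)) := by gcongr
        _ = _ := by field_simp
    have ht : t = s + 1 / M := by linarith
    rw [hPhi, show KK a b c d * t = KK a b c d * s + KK a b c d * (1/M) by rw [ht]; ring]
    rw [abs_le] at ih2 hint2 ⊢
    constructor <;> linarith [ih2.1, ih2.2, hint2.1, hint2.2]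

lemma PP_bounds {a b c d : ℝ} (ha : 0 < a) (hb : 0 < b) (hc : 0 < c) (hd : 0 < d)
    (M : ℕ) (hM : 0 < M) (k : ℕ) (hk : k ≤ M) :
    PP a b c d M k ≤ Real.exp (KK a b c d) * Real.exp (M * Phi a b c d (k / M)) ∧
    Real.exp (-KK a b c d) * Real.exp (M * Phi a b c d (k / M)) ≤ PP a b c d M k := by
  obtain ⟨h0, h⟩ := PP_est ha hb hc hd M hM k hk
  have hM' : (0:ℝ) < M := by positivity
  have hs1 : (k:ℝ) / M ≤ 1 := by rw [div_le_one hM']; exact_mod_cast hk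
  have hK := KK_nonneg ha hb hc hd
  have h2 : KK a b c d * (k / M) ≤ KK a b c d := mul_le_of_le_one_right hK hs1
  have h3 := abs_le.1 (h.trans h2)
  rw [← Real.exp_add, ← Real.exp_add]
  constructor
  · rw [← Real.log_le_iff_le_exp h0]; linarith [h3.2]
  · rw [← Real.le_log_iff_exp_le h0]; linarith [h3.1]

lemma upper {a b c d : ℝ} (ha : 0 < a) (hb : 0 < b) (hc : 0 < c) (hd : 0 < d)
    (hneg : ∀ x, 0 < x → x < 1 → Phi a b c d x < 0) (h1 : Phi a b c d 1 ≤ 0) :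
    ∀ᶠ M : ℕ in atTop, ∑ k ∈ Icc 1 M, PP a b c d M k < M := by
  set C := Real.exp (KK a b c d) with hC
  have hC1 : 1 ≤ C := Real.one_le_exp (KK_nonneg ha hb hc hd)
  set ε := 1 / (8 * C) with hε
  have hε0 : 0 < ε := by positivity
  have hCε : C * ε = 1 / 8 := by rw [hε]; field_simp
  have hε1 : ε ≤ 1 / 8 := by nlinarith
  obtain ⟨m, hm0, hm⟩ : ∃ m > 0, ∀ x, ε ≤ x → x ≤ 1 - ε → Phi a b c d x ≤ -m := by
    have hsub : Set.Icc ε (1-ε) ⊆ Set.Icc 0 1 := Set.Icc_subset_Icc (by linarith) (by linarith)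
    obtain ⟨x0, hx0, hmax⟩ := isCompact_Icc.exists_isMaxOn (Set.nonempty_Icc.2 (by linarith : ε ≤ 1 - ε))
      ((Phi_cont ha hb hc hd).mono hsub)
    refine ⟨-Phi a b c d x0, ?_, ?_⟩
    · have := hneg x0 (by linarith [hx0.1]) (by linarith [hx0.2]); linarith
    · intro x hx hx'
      have : Phi a b c d x ≤ Phi a b c d x0 := hmax ⟨hx, hx'⟩
      linarith
  have hle : ∀ x, 0 ≤ x → x ≤ 1 → Phi a b c d x ≤ 0 := by
    intro x hx hx1
    rcases hx.eq_or_lt with rfl | hx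
    · simp [Phi]
    rcases hx1.eq_or_lt with rfl | hx1
    · exact h1
    exact (hneg x hx hx1).le
  have t1 : Tendsto (fun M : ℕ => C * Real.exp (-(m * M))) atTop (𝓝 (C * 0)) := by
    apply Tendsto.const_mul
    apply Real.tendsto_exp_neg_atTop_nhds_zero.comp
    exact tendsto_natCast_atTop_atTop.const_mul_atTop hm0
  rw [mul_zero] at t1
  filter_upwards [t1.eventually_lt_const (by norm_num : (0:ℝ) < 1/4), eventually_gt_atTop 0,
    tendsto_natCast_atTop_atTop.eventually_gt_atTop (4 * C)] with M hM1 hM0 hM2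
  have hM' : (0:ℝ) < M := by positivity
  have hbd : ∀ k ∈ Icc 1 M, PP a b c d M k ≤ (if (k:ℝ) ≤ ε * M then C else 0) +
      (if (1 - ε) * M < (k:ℝ) then C else 0) + 1/4 := by
    intro k hk
    rw [Finset.mem_Icc] at hk
    have hb' := (PP_bounds ha hb hc hd M hM0 k hk.2).1
    have hs1 : (k:ℝ) / M ≤ 1 := by rw [div_le_one hM']; exact_mod_cast hk.2
    have hs0 : (0:ℝ) ≤ k / M := by positivity
    have hPC : PP a b c d M k ≤ C := by
      refine hb'.trans (mul_le_of_le_one_right (by positivity) ?_)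
      rw [Real.exp_le_one_iff]
      exact mul_nonpos_of_nonneg_of_nonpos hM'.le (hle _ hs0 hs1)
    by_cases c1 : (k:ℝ) ≤ ε * M
    · rw [if_pos c1]
      have : (0:ℝ) ≤ if (1 - ε) * M < (k:ℝ) then C else 0 := by split_ifs <;> linarith
      linarith
    by_cases c2 : (1 - ε) * M < (k:ℝ)
    · rw [if_neg c1, if_pos c2]; linarith
    rw [if_neg c1, if_neg c2]
    have := hm (k / M) (by rw [le_div_iff₀ hM']; linarith) (by rw [div_le_iff₀ hM']; linarith)
    have h5 : Real.exp (M * Phi a b c d (k / M)) ≤ Real.exp (-(m * M)) := by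
      apply Real.exp_le_exp.2; nlinarith
    have : C * Real.exp (M * Phi a b c d (k / M)) ≤ C * Real.exp (-(m * M)) := by gcongr
    linarith
  have hcard1 : (((Icc 1 M).filter (fun k : ℕ => (k:ℝ) ≤ ε * M)).card : ℝ) ≤ ε * M := by
    have hs : (Icc 1 M).filter (fun k : ℕ => (k:ℝ) ≤ ε * M) ⊆ Icc 1 ⌊ε * M⌋₊ := by
      intro k hk
      rw [Finset.mem_filter, Finset.mem_Icc] at hk
      rw [Finset.mem_Icc]
      exact ⟨hk.1.1, Nat.le_floor hk.2⟩
    have := Finset.card_le_card hs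
    rw [Nat.card_Icc, Nat.add_sub_cancel] at this
    calc _ ≤ ((⌊ε * M⌋₊ : ℕ) : ℝ) := by exact_mod_cast this
      _ ≤ _ := Nat.floor_le (by positivity)
  have hcard2 : (((Icc 1 M).filter (fun k : ℕ => (1 - ε) * M < (k:ℝ))).card : ℝ) ≤ ε * M + 1 := by
    have hs : (Icc 1 M).filter (fun k : ℕ => (1 - ε) * M < (k:ℝ)) ⊆ Ioc ⌊(1 - ε) * M⌋₊ M := by
      intro k hk
      rw [Finset.mem_filter, Finset.mem_Icc] at hk
      rw [Finset.mem_Ioc]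
      refine ⟨?_, hk.1.2⟩
      have := hk.2
      rw [Nat.floor_lt (mul_nonneg (by linarith) hM'.le)]
      exact this
    have := Finset.card_le_card hs
    rw [Nat.card_Ioc] at this
    have hfl : ⌊(1 - ε) * M⌋₊ ≤ M := by
      apply Nat.floor_le_of_le; nlinarith
    have h6 := Nat.lt_floor_add_one ((1 - ε) * (M:ℝ))
    calc _ ≤ ((M - ⌊(1 - ε) * M⌋₊ : ℕ) : ℝ) := by exact_mod_cast this
      _ = M - (⌊(1 - ε) * M⌋₊ : ℝ) := by rw [Nat.cast_sub hfl]
      _ ≤ _ := by linarith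
  have hsum := Finset.sum_le_sum hbd
  rw [Finset.sum_add_distrib, Finset.sum_add_distrib, ← Finset.sum_filter, ← Finset.sum_filter,
    Finset.sum_const, Finset.sum_const, Finset.sum_const, Nat.card_Icc, Nat.add_sub_cancel,
    nsmul_eq_mul, nsmul_eq_mul, nsmul_eq_mul] at hsum
  have g1 := mul_le_mul_of_nonneg_right hcard1 (by linarith : 0 ≤ C)
  have g2 := mul_le_mul_of_nonneg_right hcard2 (by linarith : 0 ≤ C)
  have g3 : ε * M * C = M / 8 := by
    rw [show ε * M * C = C * ε * M by ring, hCε]; ring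
  have g4 : (ε * M + 1) * C = M / 8 + C := by rw [add_mul, g3]; ring
  linarith

lemma lower {a b c d : ℝ} (ha : 0 < a) (hb : 0 < b) (hc : 0 < c) (hd : 0 < d)
    (x : ℝ) (hx0 : 0 < x) (hx1 : x ≤ 1) (hpos : 0 < Phi a b c d x) :
    ∀ᶠ M : ℕ in atTop, (M:ℝ) ≤ ∑ k ∈ Icc 1 M, PP a b c d M k := by
  have t0 : Tendsto (fun M : ℕ => ((⌊x * M⌋₊ : ℕ) : ℝ) / M) atTop (𝓝 x) :=
    (tendsto_nat_floor_mul_div_atTop hx0.le).comp tendsto_natCast_atTop_atTop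
  have hfl : ∀ M : ℕ, ⌊x * M⌋₊ ≤ M := fun M => by
    apply Nat.floor_le_of_le
    exact mul_le_of_le_one_left (by positivity) hx1
  have t1 : Tendsto (fun M : ℕ => Phi a b c d (((⌊x * M⌋₊ : ℕ) : ℝ) / M)) atTop
      (𝓝 (Phi a b c d x)) := by
    apply ((Phi_cont ha hb hc hd) x ⟨hx0.le, hx1⟩).tendsto.comp
    apply tendsto_nhdsWithin_iff.2 ⟨t0, ?_⟩
    filter_upwards [eventually_gt_atTop 0] with M hM
    have hM' : (0:ℝ) < M := by positivity
    refine ⟨by positivity, ?_⟩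
    rw [div_le_one hM']; exact_mod_cast hfl M
  set m := Phi a b c d x / 2 with hm
  have hm0 : 0 < m := by positivity
  have t2 : Tendsto (fun M : ℕ => Real.exp (m * M) / (m * M)) atTop atTop := by
    have := Real.tendsto_exp_div_pow_atTop 1
    simp only [pow_one] at this
    exact this.comp (tendsto_natCast_atTop_atTop.const_mul_atTop hm0)
  filter_upwards [t1.eventually_const_lt (by linarith : m < Phi a b c d x),
    eventually_gt_atTop 0, t2.eventually_ge_atTop (Real.exp (KK a b c d) / m),
    (tendsto_natCast_atTop_atTop.const_mul_atTop hx0).eventually_ge_atTop 1] with M h1 hM0 h2 h3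
  have hM' : (0:ℝ) < M := by positivity
  have hk := (PP_bounds ha hb hc hd M hM0 _ (hfl M)).2
  have hmem : ⌊x * M⌋₊ ∈ Icc 1 M := by
    rw [Finset.mem_Icc]; exact ⟨Nat.le_floor (by simpa using h3), hfl M⟩
  have hs := Finset.single_le_sum (f := fun k => PP a b c d M k) (s := Icc 1 M)
    (fun i hi => (PP_est ha hb hc hd M hM0 i (Finset.mem_Icc.1 hi).2).1.le) hmem
  refine le_trans ?_ hs
  refine le_trans ?_ hk
  rw [Real.exp_neg]
  have h4 : Real.exp (m * M) ≤ Real.exp (M * Phi a b c d (((⌊x * M⌋₊ : ℕ) : ℝ) / M)) := by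
    apply Real.exp_le_exp.2; nlinarith
  rw [div_le_div_iff₀ hm0 (by positivity)] at h2
  have h5 : Real.exp (KK a b c d) * M ≤ Real.exp (m * M) := by
    have : m * (Real.exp (KK a b c d) * M) ≤ m * Real.exp (m * M) := by linarith
    exact le_of_mul_le_mul_left this hm0
  rw [inv_mul_eq_div, le_div_iff₀ (Real.exp_pos _)]
  linarith

lemma rho_iff {a b c d : ℝ} (ha : 0 < a) (hb : 0 < b) (hc : 0 < c) (hd : 0 < d)
    (M : ℕ) (hM : 0 < M) :
    rhoA a b c d (M+1) > 1 / ((M+1 : ℕ) : ℝ) ↔ ∑ k ∈ Icc 1 M, PP a b c d M k < M := by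
  have hs : 0 ≤ ∑ k ∈ Icc 1 M, PP a b c d M k := Finset.sum_nonneg
    (fun i hi => (PP_est ha hb hc hd M hM i (Finset.mem_Icc.1 hi).2).1.le)
  have : rhoA a b c d (M+1) = 1 / (1 + ∑ k ∈ Icc 1 M, PP a b c d M k) := rfl
  rw [this, gt_iff_lt, one_div_lt_one_div (by positivity) (by positivity)]
  push_cast
  constructor <;> intro h <;> linarith

lemma ev_iff {a b c d : ℝ} (ha : 0 < a) (hb : 0 < b) (hc : 0 < c) (hd : 0 < d) :
    (∃ N₀ : ℕ, ∀ N : ℕ, N₀ ≤ N → rhoA a b c d N > 1 / (N : ℝ)) ↔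
      ∀ᶠ M : ℕ in atTop, ∑ k ∈ Icc 1 M, PP a b c d M k < M := by
  rw [eventually_atTop]
  constructor
  · rintro ⟨N₀, h⟩
    refine ⟨N₀ + 1, fun M hM => ?_⟩
    exact (rho_iff ha hb hc hd M (by omega)).1 (h (M+1) (by omega))
  · rintro ⟨N₀, h⟩
    refine ⟨N₀ + 2, fun N hN => ?_⟩
    obtain ⟨M, rfl⟩ : ∃ M, N = M + 1 := ⟨N - 1, by omega⟩
    exact (rho_iff ha hb hc hd M (by omega)).2 (h M (by omega))

lemma not_ev {a b c d : ℝ} (h : ∀ᶠ M : ℕ in atTop, (M:ℝ) ≤ ∑ k ∈ Icc 1 M, PP a b c d M k) :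
    ¬ ∀ᶠ M : ℕ in atTop, ∑ k ∈ Icc 1 M, PP a b c d M k < M := by
  intro h'
  obtain ⟨M, h1, h2⟩ := (h.and h').exists
  linarith

lemma phi_neg {a b c d x : ℝ} (ha : 0 < a) (hb : 0 < b) (hc : 0 < c) (hd : 0 < d)
    (h0 : 0 ≤ x) (h1 : x ≤ 1) (h : (d - b) * (1 - x) + (c - a) * x < 0) : phi a b c d x < 0 := by
  rw [phi_eq ha hb hc hd h0 h1, sub_neg]
  exact Real.log_lt_log (aff_pos hd hc h0 h1) (by linarith)

lemma phi_pos {a b c d x : ℝ} (ha : 0 < a) (hb : 0 < b) (hc : 0 < c) (hd : 0 < d)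
    (h0 : 0 ≤ x) (h1 : x ≤ 1) (h : 0 < (d - b) * (1 - x) + (c - a) * x) : 0 < phi a b c d x := by
  rw [phi_eq ha hb hc hd h0 h1, sub_pos]
  exact Real.log_lt_log (aff_pos hb ha h0 h1) (by linarith)

lemma Phi_pos {a b c d x : ℝ} (ha : 0 < a) (hb : 0 < b) (hc : 0 < c) (hd : 0 < d)
    (h0 : 0 < x) (h1 : x ≤ 1) (h : ∀ t, 0 < t → t < x → 0 < (d - b) * (1 - t) + (c - a) * t) :
    0 < Phi a b c d x :=
  intervalIntegral.intervalIntegral_pos_of_pos_on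
    (phi_int ha hb hc hd le_rfl zero_le_one h0.le h1)
    (fun t ht => phi_pos ha hb hc hd ht.1.le (ht.2.le.trans h1) (h t ht.1 ht.2)) h0

lemma Phi_neg {a b c d x : ℝ} (ha : 0 < a) (hb : 0 < b) (hc : 0 < c) (hd : 0 < d)
    (h0 : 0 < x) (h1 : x ≤ 1) (h : ∀ t, 0 < t → t < x → (d - b) * (1 - t) + (c - a) * t < 0) :
    Phi a b c d x < 0 := by
  have : 0 < ∫ t in (0:ℝ)..x, -phi a b c d t :=
    intervalIntegral.intervalIntegral_pos_of_pos_on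
    (phi_int ha hb hc hd le_rfl zero_le_one h0.le h1).neg
    (fun t ht => neg_pos.2
      (phi_neg ha hb hc hd ht.1.le (ht.2.le.trans h1) (h t ht.1 ht.2))) h0
  rw [intervalIntegral.integral_neg] at this
  unfold Phi; linarith

lemma Phi_neg' {a b c d x : ℝ} (ha : 0 < a) (hb : 0 < b) (hc : 0 < c) (hd : 0 < d)
    (h0 : 0 < x) (h1 : x < 1) (hbd : d < b) (hac : a < c) (hI : Phi a b c d 1 ≤ 0) :
    Phi a b c d x < 0 := by
  by_cases hx : (d - b) * (1 - x) + (c - a) * x ≤ 0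
  · apply Phi_neg ha hb hc hd h0 h1.le
    intro t ht htx
    nlinarith
  · push Not at hx
    have h2 : 0 < ∫ t in x..1, phi a b c d t :=
      intervalIntegral.intervalIntegral_pos_of_pos_on
        (phi_int ha hb hc hd h0.le h1.le zero_le_one le_rfl)
        (fun t ht => phi_pos ha hb hc hd (h0.le.trans ht.1.le) ht.2.le
          (by have := ht.1; nlinarith)) h1
    have h3 : Phi a b c d x + ∫ t in x..1, phi a b c d t = Phi a b c d 1 :=
      intervalIntegral.integral_add_adjacent_intervals
        (phi_int ha hb hc hd le_rfl zero_le_one h0.le h1.le)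
        (phi_int ha hb hc hd h0.le h1.le zero_le_one le_rfl)
    linarith

lemma ratio_eq' {a b c d : ℝ} (hbd : b = d) (hac : a = c) (M j : ℕ) (hM : 0 < M) :
    fB c d (M+1) (j+1) / fA a b (M+1) (j+1) =
      (d + ((j+1 : ℕ) / (M:ℝ)) * (c - d)) / (d + ((j:ℝ) / M) * (c - d)) := by
  rw [ratio_eq a b c d M j hM, hbd, hac]

lemma special {c d : ℝ} (hc : 0 < c) (hd : 0 < d) :
    (∀ᶠ M : ℕ in atTop, ∑ k ∈ Icc 1 M, PP c d c d M k < M) ↔ d > c := by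
  -- the product telescopes
  have tel : ∀ M : ℕ, 0 < M → ∀ k, k ≤ M → PP c d c d M k = (d + (k / (M:ℝ)) * (c - d)) / d := by
    intro M hM k hk
    have hM' : (0:ℝ) < M := by positivity
    induction k with
    | zero => simp [PP, hd.ne']
    | succ k ih =>
      have hs1 : (k:ℝ) / M ≤ 1 := by rw [div_le_one hM']; exact_mod_cast (by omega)
      have hp := aff_pos hd hc (by positivity : (0:ℝ) ≤ k / M) hs1
      have : PP c d c d M (k+1) = PP c d c d M k * (fB c d (M+1) (k+1) / fA c d (M+1) (k+1)) := by
        unfold PP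
        rw [Finset.prod_Icc_succ_top (by omega)]
      rw [this, ih (by omega), ratio_eq c d c d M k hM]
      rw [div_mul_div_comm, mul_comm d, mul_div_mul_left _ _ hp.ne']
  constructor
  · intro h
    by_contra hcd
    push Not at hcd
    refine not_ev ?_ h
    filter_upwards [eventually_gt_atTop 0] with M hM
    calc (M:ℝ) = ∑ k ∈ Icc 1 M, (1:ℝ) := by simp
      _ ≤ _ := by
        apply Finset.sum_le_sum
        intro k hk
        rw [tel M hM k (Finset.mem_Icc.1 hk).2, le_div_iff₀ hd]
        have : 0 ≤ (k / (M:ℝ)) * (c - d) := mul_nonneg (by positivity) (by linarith)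
        linarith
  · intro hcd
    filter_upwards [eventually_gt_atTop 0] with M hM
    calc _ < ∑ k ∈ Icc 1 M, (1:ℝ) := by
          apply Finset.sum_lt_sum_of_nonempty (Finset.nonempty_Icc.2 hM)
          intro k hk
          rw [Finset.mem_Icc] at hk
          rw [tel M hM k hk.2, div_lt_one hd]
          have hk0 : 0 < k := hk.1
          have : 0 < (k / (M:ℝ)) * (d - c) := mul_pos (by positivity) (by linarith)
          linarith
      _ = M := by simp

/-- ρ_A > 1/N for all sufficiently large N iff one of:
(i) b > d and a ≥ c; (ii) b > d, a < c and I ≤ 0; (iii) b = d and a > c;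
(iv) b = d, a = c and b > c. -/
theorem rhoA_gt_neutral_largeN (a b c d : ℝ) (ha : 0 < a) (hb : 0 < b) (hc : 0 < c)
    (hd : 0 < d) :
    (∃ N₀ : ℕ, ∀ N : ℕ, N₀ ≤ N → rhoA a b c d N > 1 / (N : ℝ)) ↔
      ((b > d ∧ a ≥ c) ∨
       (b > d ∧ a < c ∧
         (∫ x in (0 : ℝ)..1, Real.log ((d + x * (c - d)) / (b + x * (a - b)))) ≤ 0) ∨
       (b = d ∧ a > c) ∨
       (b = d ∧ a = c ∧ b > c)) := by
  rw [ev_iff ha hb hc hd]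
  change _ ↔ ((b > d ∧ a ≥ c) ∨ (b > d ∧ a < c ∧ Phi a b c d 1 ≤ 0) ∨
       (b = d ∧ a > c) ∨ (b = d ∧ a = c ∧ b > c))
  constructor
  · intro h
    rcases lt_trichotomy b d with hbd | hbd | hbd
    · exfalso
      -- positive drift near zero
      set x := (d - b) / (d - b + |c - a| + 1) with hx
      have hden : 0 < d - b + |c - a| + 1 := by have := abs_nonneg (c - a); linarith
      have hx0 : 0 < x := div_pos (by linarith) hden
      have hx1 : x ≤ 1 := by
        rw [hx, div_le_one hden]; have := abs_nonneg (c - a); linarith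
      refine not_ev (lower ha hb hc hd x hx0 hx1 (Phi_pos ha hb hc hd hx0 hx1 ?_)) h
      intro t ht htx
      rw [hx, lt_div_iff₀ hden] at htx
      have := neg_abs_le (c - a)
      nlinarith
    · rcases lt_trichotomy a c with hac | hac | hac
      · exfalso
        refine not_ev (lower ha hb hc hd 1 one_pos le_rfl (Phi_pos ha hb hc hd one_pos le_rfl ?_)) h
        intro t ht htx
        rw [hbd]
        have := mul_pos (sub_pos.2 hac) ht
        linarith
      · subst hbd hac
        exact Or.inr (Or.inr (Or.inr ⟨rfl, rfl, (special hc hd).1 h⟩))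
      · exact Or.inr (Or.inr (Or.inl ⟨hbd, hac⟩))
    · rcases lt_or_ge a c with hac | hac
      · refine Or.inr (Or.inl ⟨hbd, hac, ?_⟩)
        by_contra hI
        push Not at hI
        exact not_ev (lower ha hb hc hd 1 one_pos le_rfl hI) h
      · exact Or.inl ⟨hbd, hac⟩
  · rintro (⟨hbd, hac⟩ | ⟨hbd, hac, hI⟩ | ⟨hbd, hac⟩ | ⟨hbd, hac, hbc⟩)
    · have hneg : ∀ x, 0 < x → x ≤ 1 → Phi a b c d x < 0 := by
        intro x h0 h1
        apply Phi_neg ha hb hc hd h0 h1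
        intro t ht htx
        have := mul_pos (sub_pos.2 hbd) (by linarith : 0 < 1 - t)
        have := mul_nonneg (sub_nonneg.2 hac) ht.le
        linarith
      exact upper ha hb hc hd (fun x h0 h1 => hneg x h0 h1.le) (hneg 1 one_pos le_rfl).le
    · exact upper ha hb hc hd (fun x h0 h1 => Phi_neg' ha hb hc hd h0 h1 hbd hac hI) hI
    · have hneg : ∀ x, 0 < x → x ≤ 1 → Phi a b c d x < 0 := by
        intro x h0 h1
        apply Phi_neg ha hb hc hd h0 h1
        intro t ht htx
        rw [hbd]
        have := mul_pos (sub_pos.2 hac) ht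
        linarith
      exact upper ha hb hc hd (fun x h0 h1 => hneg x h0 h1.le) (hneg 1 one_pos le_rfl).le
    · subst hbd hac
      exact (special hc hd).2 hbc
end

section
/- Let a, b, c, d be positive real numbers and let I = ∫₀¹ ln((d + x(c−d))/(b + x(a−b))) dx. If I < 0, or if I = 0 and ac < bd, then ρ_A(N) > ρ_B(N) for all sufficiently large N. Conversely, if I > 0, or if I = 0 and ac > bd, then ρ_A(N) < ρ_B(N) for all sufficiently large N. -/
open Filter Finset Topology

lemma aux_trap (f : ℝ → ℝ) (hf : ContDiffOn ℝ 2 f (Set.uIcc 0 1)) :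
    ∃ K : ℝ, ∀ n : ℕ, 0 < n →
      |((f 0 + f 1) / 2 + ∑ k ∈ range (n - 1), f (((k : ℝ) + 1) / n)) - n * ∫ x in (0 : ℝ)..1, f x|
        ≤ K / n := by
  have hu : UniqueDiffOn ℝ (Set.uIcc (0 : ℝ) 1) := uniqueDiffOn_uIcc (by norm_num)
  have hcont := hf.continuousOn_iteratedDerivWithin (m := 2) le_rfl hu
  obtain ⟨C, hC⟩ := isCompact_uIcc.exists_bound_of_continuousOn hcont
  have hC0 : 0 ≤ C := (norm_nonneg _).trans (hC 0 Set.left_mem_uIcc)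
  have hb : ∀ x, |iteratedDerivWithin 2 f (Set.uIcc 0 1) x| ≤ C := by
    intro x
    by_cases hx : x ∈ Set.uIcc (0 : ℝ) 1
    · exact hC x hx
    · rw [iteratedDerivWithin_succ, derivWithin_zero_of_notMem_closure
        (by rwa [isCompact_uIcc.isClosed.closure_eq]), abs_zero]
      exact hC0
  refine ⟨C / 12, fun n hn => ?_⟩
  have h := trapezoidal_error_le_of_c2 hf hb hn
  have hn' : (0 : ℝ) < n := by exact_mod_cast hn
  unfold trapezoidal_error trapezoidal_integral at h
  simp only [sub_zero, zero_add, mul_one, abs_one, one_pow, one_mul] at h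
  have e : ((f 0 + f 1) / 2 + ∑ k ∈ range (n - 1), f (((k : ℝ) + 1) / n))
      - n * ∫ x in (0 : ℝ)..1, f x
      = n * (1 / n * ((f 0 + f 1) / 2 + ∑ k ∈ range (n - 1), f (((k : ℝ) + 1) / n))
        - ∫ x in (0 : ℝ)..1, f x) := by
    field_simp
  rw [e, abs_mul, abs_of_pos hn']
  calc _ ≤ (n : ℝ) * (C / (12 * (n : ℝ) ^ 2)) := by gcongr
    _ = _ := by field_simp

lemma aux_sum (r : ℕ → ℝ) (n : ℕ) (hr : ∀ j, 1 ≤ j → j ≤ n → r j ≠ 0) :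
    (∑ k ∈ range (n + 1), ∏ j ∈ range k, (r (n - j))⁻¹) * ∏ j ∈ range n, r (j + 1)
      = ∑ k ∈ range (n + 1), ∏ j ∈ range k, r (j + 1) := by
  rw [← sum_range_reflect (fun k => ∏ j ∈ range k, r (j + 1)), sum_mul]
  refine sum_congr rfl fun k hk => ?_
  have hk' : k ≤ n := by simpa [Nat.lt_succ_iff] using hk
  have e : n = (n - k) + k := by omega
  have e2 : ∏ j ∈ range n, r (j + 1)
      = (∏ j ∈ range (n - k), r (j + 1)) * ∏ j ∈ range k, r (n - j) := by
    conv_lhs => rw [e, prod_range_add]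
    congr 1
    rw [← prod_range_reflect]
    refine prod_congr rfl fun j hj => ?_
    have : j < k := by simpa using hj
    congr 1
    omega
  rw [e2, prod_inv_distrib]
  have hne : ∏ j ∈ range k, r (n - j) ≠ 0 := by
    refine prod_ne_zero_iff.2 fun j hj => hr _ ?_ ?_
    · have : j < k := by simpa using hj
      omega
    · omega
  have e3 : n + 1 - 1 - k = n - k := by omega
  rw [e3]
  field_simp

lemma aux_Icc (F : ℕ → ℝ) (k : ℕ) : ∏ j ∈ Icc 1 k, F j = ∏ j ∈ range k, F (j + 1) := by
  rw [range_eq_Ico, prod_Ico_add' F 0 k 1]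
  rfl

lemma aux_S (F : ℕ → ℝ) (n : ℕ) : 1 + ∑ k ∈ Icc 1 n, ∏ j ∈ Icc 1 k, F j
    = ∑ k ∈ range (n + 1), ∏ j ∈ range k, F (j + 1) := by
  rw [sum_range_succ', add_comm]
  simp only [aux_Icc, prod_range_zero]
  congr 1
  rw [range_eq_Ico, sum_Ico_add' (fun k => ∏ j ∈ range k, F (j + 1)) 0 n 1]
  rfl

lemma aux_lin {p q x : ℝ} (hp : 0 < p) (hq : 0 < q) (h0 : 0 ≤ x) (h1 : x ≤ 1) :
    0 < p + x * (q - p) := by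
  nlinarith [mul_nonneg h0 hq.le, mul_nonneg (sub_nonneg.2 h1) hp.le, lt_min hp hq,
    mul_nonneg h0 (sub_nonneg.2 (min_le_right p q)),
    mul_nonneg (sub_nonneg.2 h1) (sub_nonneg.2 (min_le_left p q))]

lemma aux_fA (a b : ℝ) (n i : ℕ) (hn : 0 < n) :
    fA a b (n + 1) (i + 1) = b + ((i : ℝ) / n) * (a - b) := by
  have hn' : (n : ℝ) ≠ 0 := by positivity
  unfold fA
  push_cast
  simp only [add_sub_cancel_right]
  field_simp
  ring

lemma aux_fB (c d : ℝ) (n i : ℕ) (hn : 0 < n) :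
    fB c d (n + 1) (i + 1) = d + (((i : ℝ) + 1) / n) * (c - d) := by
  have hn' : (n : ℝ) ≠ 0 := by positivity
  unfold fB
  push_cast
  simp only [add_sub_cancel_right]
  field_simp
  ring

lemma aux_fA_pos {a b : ℝ} (ha : 0 < a) (hb : 0 < b) (n i : ℕ) (hn : 0 < n) (hi : i < n) :
    0 < fA a b (n + 1) (i + 1) := by
  have hn' : (0 : ℝ) < n := by positivity
  have : (i : ℝ) ≤ n := by exact_mod_cast hi.le
  rw [aux_fA _ _ _ _ hn]
  exact aux_lin hb ha (by positivity) ((div_le_one hn').2 this)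

lemma aux_fB_pos {c d : ℝ} (hc : 0 < c) (hd : 0 < d) (n i : ℕ) (hn : 0 < n) (hi : i < n) :
    0 < fB c d (n + 1) (i + 1) := by
  have hn' : (0 : ℝ) < n := by positivity
  have : (i : ℝ) + 1 ≤ n := by exact_mod_cast hi
  rw [aux_fB _ _ _ _ hn]
  exact aux_lin hd hc (by positivity) ((div_le_one hn').2 this)

/-- The ratio identity, in a form convenient for comparison. -/
lemma aux_ratio {a b c d : ℝ} (ha : 0 < a) (hb : 0 < b) (hc : 0 < c) (hd : 0 < d)
    (n : ℕ) (hn : 0 < n) :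
    0 < rhoA a b c d (n + 1) ∧ rhoB a b c d (n + 1) = rhoA a b c d (n + 1) *
      ∏ i ∈ range n, (fB c d (n + 1) (i + 1) / fA a b (n + 1) (i + 1)) := by
  set r : ℕ → ℝ := fun j => fB c d (n + 1) j / fA a b (n + 1) j with hrdef
  have hr : ∀ j, j < n → 0 < r (j + 1) := fun j hj =>
    div_pos (aux_fB_pos hc hd n j hn hj) (aux_fA_pos ha hb n j hn hj)
  have hA : rhoA a b c d (n + 1) = 1 / ∑ k ∈ range (n + 1), ∏ j ∈ range k, r (j + 1) := by
    unfold rhoA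
    rw [Nat.add_sub_cancel, aux_S (fun j => fB c d (n + 1) j / fA a b (n + 1) j)]
  have hB : rhoB a b c d (n + 1) = 1 / ∑ k ∈ range (n + 1), ∏ j ∈ range k, (r (n - j))⁻¹ := by
    unfold rhoB
    rw [Nat.add_sub_cancel,
      aux_S (fun j => fA a b (n + 1) (n + 1 - j) / fB c d (n + 1) (n + 1 - j))]
    simp only [hrdef, inv_div, Nat.add_sub_add_right]
  have hs := aux_sum r n (fun j h1 h2 => by
    obtain ⟨i, rfl⟩ := Nat.exists_eq_add_of_le' h1
    exact (hr i (by omega)).ne')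
  have hSpos : 0 < ∑ k ∈ range (n + 1), ∏ j ∈ range k, r (j + 1) := by
    refine sum_pos (fun k hk => prod_pos fun j hj => hr j ?_) ⟨0, by simp⟩
    simp at hk hj
    omega
  have hPpos : 0 < ∏ j ∈ range n, r (j + 1) :=
    prod_pos fun j hj => hr j (by simpa using hj)
  rw [hA, hB]
  refine ⟨by positivity, ?_⟩
  change _ = _ * ∏ j ∈ range n, r (j + 1)
  rw [← hs] at hSpos ⊢
  have : (∑ k ∈ range (n + 1), ∏ j ∈ range k, (r (n - j))⁻¹) ≠ 0 := by
    intro h; rw [h] at hSpos; simp at hSpos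
  field_simp

lemma aux_log {a b c d : ℝ} (ha : 0 < a) (hb : 0 < b) (hc : 0 < c) (hd : 0 < d) :
    ∃ K : ℝ, ∀ n : ℕ, 0 < n →
      |Real.log (∏ i ∈ range n, (fB c d (n + 1) (i + 1) / fA a b (n + 1) (i + 1)))
        - (n * (∫ x in (0 : ℝ)..1, Real.log ((d + x * (c - d)) / (b + x * (a - b))))
          + (Real.log (a * c) - Real.log (b * d)) / 2)| ≤ K / n := by
  set f : ℝ → ℝ := fun x => Real.log ((d + x * (c - d)) / (b + x * (a - b))) with hf
  have hcd : ContDiffOn ℝ 2 f (Set.uIcc 0 1) := by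
    rw [Set.uIcc_of_le zero_le_one]
    have hg : ∀ x ∈ Set.Icc (0 : ℝ) 1, d + x * (c - d) ≠ 0 := fun x hx =>
      (aux_lin hd hc hx.1 hx.2).ne'
    have hh : ∀ x ∈ Set.Icc (0 : ℝ) 1, b + x * (a - b) ≠ 0 := fun x hx =>
      (aux_lin hb ha hx.1 hx.2).ne'
    refine ContDiffOn.log (ContDiffOn.div ?_ ?_ hh) fun x hx => div_ne_zero (hg x hx) (hh x hx)
    · exact ContDiff.contDiffOn (by fun_prop)
    · exact ContDiff.contDiffOn (by fun_prop)
  obtain ⟨K, hK⟩ := aux_trap f hcd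
  refine ⟨K, fun n hn => ?_⟩
  have h := hK n hn
  suffices e : Real.log (∏ i ∈ range n, (fB c d (n + 1) (i + 1) / fA a b (n + 1) (i + 1)))
      = ((f 0 + f 1) / 2 + ∑ k ∈ range (n - 1), f (((k : ℝ) + 1) / n))
        + (Real.log (a * c) - Real.log (b * d)) / 2 by
    rw [e]
    convert h using 2
    ring
  have f0 : f 0 = Real.log d - Real.log b := by
    simp [hf, Real.log_div hd.ne' hb.ne']
  have f1 : f 1 = Real.log c - Real.log a := by
    simp [hf, Real.log_div hc.ne' ha.ne']
  rw [f0, f1, Real.log_mul ha.ne' hc.ne', Real.log_mul hb.ne' hd.ne', prod_div_distrib]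
  have hBp : ∀ i ∈ range n, fB c d (n + 1) (i + 1) ≠ 0 := fun i hi =>
    (aux_fB_pos hc hd n i hn (by simpa using hi)).ne'
  have hAp : ∀ i ∈ range n, fA a b (n + 1) (i + 1) ≠ 0 := fun i hi =>
    (aux_fA_pos ha hb n i hn (by simpa using hi)).ne'
  rw [Real.log_div (prod_ne_zero_iff.2 hBp) (prod_ne_zero_iff.2 hAp), Real.log_prod hBp,
    Real.log_prod hAp]
  obtain ⟨m, rfl⟩ := Nat.exists_eq_add_of_le' hn
  rw [sum_range_succ, sum_range_succ', Nat.add_sub_cancel]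
  have l1 : fB c d (m + 1 + 1) (m + 1) = c := by
    rw [aux_fB _ _ _ _ hn]
    push_cast
    rw [div_self (by positivity)]
    ring
  have l2 : fA a b (m + 1 + 1) (0 + 1) = b := by
    rw [aux_fA _ _ _ _ hn]
    simp
  have l3 : ∑ k ∈ range m, f (((k : ℝ) + 1) / ((m + 1 : ℕ) : ℝ))
      = ∑ i ∈ range m, Real.log (fB c d (m + 1 + 1) (i + 1))
        - ∑ i ∈ range m, Real.log (fA a b (m + 1 + 1) (i + 1 + 1)) := by
    rw [← sum_sub_distrib]
    refine sum_congr rfl fun i hi => ?_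
    have hi' : i < m := by simpa using hi
    rw [← Real.log_div (hBp i (by simp; omega)) (hAp (i + 1) (by simp; omega)),
      aux_fB _ _ _ _ hn, aux_fA _ _ _ _ hn, hf]
    push_cast
    rfl
  rw [l1, l2, l3]
  ring

/-- Sign of `n * I + L` with an `O(1/n)` error. -/
lemma aux_neg (u : ℕ → ℝ) (I L K : ℝ) (hu : ∀ n : ℕ, 0 < n → |u n - (n * I + L)| ≤ K / n)
    (h : I < 0 ∨ (I = 0 ∧ L < 0)) : ∀ᶠ n in atTop, u n < 0 := by
  have hK : Tendsto (fun n : ℕ => K / (n : ℝ)) atTop (𝓝 0) :=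
    tendsto_const_div_atTop_nhds_zero_nat K
  have hle : ∀ᶠ n : ℕ in atTop, u n ≤ n * I + (L + K / n) := by
    filter_upwards [eventually_gt_atTop 0] with n hn
    have := (abs_le.1 (hu n hn)).2
    linarith
  have hlim : Tendsto (fun n : ℕ => L + K / (n : ℝ)) atTop (𝓝 L) := by
    simpa using hK.const_add L
  have hneg : ∀ᶠ n : ℕ in atTop, n * I + (L + K / n) < 0 := by
    rcases h with h | ⟨h, hL⟩
    · have : Tendsto (fun n : ℕ => (n : ℝ) * I + (L + K / n)) atTop atBot :=
        (tendsto_natCast_atTop_atTop.atTop_mul_const_of_neg h).atBot_add hlim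
      exact this.eventually_lt_atBot 0
    · simpa [h] using hlim.eventually_lt_const hL
  filter_upwards [hle, hneg] with n h1 h2
  linarith

/-- If I < 0, or I = 0 and ac < bd, then ρ_A > ρ_B for all sufficiently large N;
if I > 0, or I = 0 and ac > bd, then ρ_A < ρ_B for all sufficiently large N. -/
theorem rhoA_vs_rhoB_largeN (a b c d : ℝ) (ha : 0 < a) (hb : 0 < b) (hc : 0 < c)
    (hd : 0 < d) :
    (((∫ x in (0 : ℝ)..1, Real.log ((d + x * (c - d)) / (b + x * (a - b)))) < 0 ∨
        ((∫ x in (0 : ℝ)..1, Real.log ((d + x * (c - d)) / (b + x * (a - b)))) = 0 ∧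
          a * c < b * d)) →
      ∃ N₀ : ℕ, ∀ N : ℕ, N₀ ≤ N → rhoA a b c d N > rhoB a b c d N) ∧
    ((0 < (∫ x in (0 : ℝ)..1, Real.log ((d + x * (c - d)) / (b + x * (a - b)))) ∨
        ((∫ x in (0 : ℝ)..1, Real.log ((d + x * (c - d)) / (b + x * (a - b)))) = 0 ∧
          b * d < a * c)) →
      ∃ N₀ : ℕ, ∀ N : ℕ, N₀ ≤ N → rhoA a b c d N < rhoB a b c d N) := by
  obtain ⟨K, hK⟩ := aux_log ha hb hc hd
  set I := ∫ x in (0 : ℝ)..1, Real.log ((d + x * (c - d)) / (b + x * (a - b)))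
  set P : ℕ → ℝ := fun n => ∏ i ∈ range n, (fB c d (n + 1) (i + 1) / fA a b (n + 1) (i + 1))
    with hP
  have hPpos : ∀ n, 0 < n → 0 < P n := fun n hn => prod_pos fun i hi =>
    div_pos (aux_fB_pos hc hd n i hn (by simpa using hi))
      (aux_fA_pos ha hb n i hn (by simpa using hi))
  constructor
  · intro h
    have h' : I < 0 ∨ (I = 0 ∧ (Real.log (a * c) - Real.log (b * d)) / 2 < 0) := by
      refine h.imp id fun ⟨h1, h2⟩ => ⟨h1, ?_⟩
      have := Real.log_lt_log (by positivity) h2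
      linarith
    have hev := aux_neg (fun n => Real.log (P n)) I _ K hK h'
    obtain ⟨M, hM⟩ := eventually_atTop.1 hev
    refine ⟨M + 2, fun N hN => ?_⟩
    obtain ⟨n, rfl⟩ : ∃ n, N = n + 1 := ⟨N - 1, by omega⟩
    have hn : 0 < n := by omega
    obtain ⟨hApos, hr⟩ := aux_ratio ha hb hc hd n hn
    have hlt : P n < 1 := (Real.log_neg_iff (hPpos n hn)).1 (hM n (by omega))
    rw [gt_iff_lt, hr]
    exact mul_lt_of_lt_one_right hApos hlt
  · intro h
    have h' : -I < 0 ∨ (-I = 0 ∧ -((Real.log (a * c) - Real.log (b * d)) / 2) < 0) := by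
      refine h.imp neg_neg_of_pos fun ⟨h1, h2⟩ => ⟨by rw [h1, neg_zero], ?_⟩
      have := Real.log_lt_log (by positivity) h2
      linarith
    have hev := aux_neg (fun n => -Real.log (P n)) (-I) _ K (fun n hn => by
      rw [← abs_neg]
      convert hK n hn using 2
      ring) h'
    obtain ⟨M, hM⟩ := eventually_atTop.1 hev
    refine ⟨M + 2, fun N hN => ?_⟩
    obtain ⟨n, rfl⟩ : ∃ n, N = n + 1 := ⟨N - 1, by omega⟩
    have hn : 0 < n := by omega
    obtain ⟨hApos, hr⟩ := aux_ratio ha hb hc hd n hn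
    have hlt : 1 < P n :=
      (Real.log_pos_iff (hPpos n hn).le).1 (neg_neg_iff_pos.1 (hM n (by omega)))
    rw [hr]
    exact lt_mul_of_one_lt_right hApos hlt
end
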